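/- Let n > 4 be an even integer, let A_1, …, A_n be points in ℝ² lying on a circle in anticlockwise order with circumradius R, and set δ(1) := ∏_{i=2}^{n−1} ∏_{j=i+1}^{n} δ_{ij} (the product of all pairwise distances among the vertices other than A_1). Then δ(1) = (∏_{k=1}^{n−3} ∏_{l odd, k+2 ≤ l ≤ n−1} S_{k+1,l,l+1}·R) · (∏_{k even, 2 ≤ k ≤ n−3} ∏_{l odd, k+2 ≤ l ≤ n−1} (1 / x_{l,l+1})). -/

import Mathlib

open Finset

/-- Squared distance between two points of `ℝ × ℝ`. -/
noncomputable def sqDist (P Q : ℝ × ℝ) : ℝ := (Q.1 - P.1)^2 + (Q.2 - P.2)^2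

/-- Distance between two points of `ℝ × ℝ`. -/
noncomputable def pdist (P Q : ℝ × ℝ) : ℝ := Real.sqrt (sqDist P Q)

/-- Four times the signed area of the triangle `P Q T`. -/
noncomputable def S4 (P Q T : ℝ × ℝ) : ℝ :=
  2 * ((Q.1 - P.1) * (T.2 - P.2) - (Q.2 - P.2) * (T.1 - P.1))

/-- The product of all pairwise distances among the vertices `A_1,…,A_n` other than `A_m`. -/
noncomputable def deltaProd (A : ℤ → ℝ × ℝ) (n m : ℤ) : ℝ :=
  ∏ i ∈ (Finset.Icc 1 (n-1)).filter (fun i => i ≠ m),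
    ∏ j ∈ (Finset.Icc (i+1) n).filter (fun j => j ≠ m), pdist (A i) (A j)

theorem aux_theta (n : ℤ) (θ : ℤ → ℝ)
    (hmono : ∀ i, 1 ≤ i → i < n → θ i < θ (i + 1)) (i : ℤ) (hi : 1 ≤ i) (d : ℕ) :
    i + d + 1 ≤ n → θ i < θ (i + d + 1) := by
  induction d with
  | zero => intro h; simpa using hmono i hi (by push_cast at h; omega)
  | succ d ih =>
    intro h
    push_cast at h ⊢
    have h1 := ih (by omega)
    have h2 := hmono (i + d + 1) (by omega) (by omega)
    have e : i + (d + 1) + 1 = i + (d : ℤ) + 1 + 1 := by ring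
    rw [e]; linarith

theorem aux_theta_lt (n : ℤ) (θ : ℤ → ℝ)
    (hmono : ∀ i, 1 ≤ i → i < n → θ i < θ (i + 1)) (i j : ℤ) (hi : 1 ≤ i) (hij : i < j)
    (hj : j ≤ n) : θ i < θ j := by
  have h := aux_theta n θ hmono i hi (j - i - 1).toNat (by omega)
  have e : i + ((j - i - 1).toNat : ℤ) + 1 = j := by omega
  rwa [e] at h

theorem aux_pdist (O : ℝ × ℝ) (R a b : ℝ) (hR : 0 < R) (hab : a < b)
    (hb : b < a + 2 * Real.pi) :
    pdist (O.1 + R * Real.cos a, O.2 + R * Real.sin a)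
      (O.1 + R * Real.cos b, O.2 + R * Real.sin b) = 2 * R * Real.sin ((b - a) / 2) := by
  have hs : 0 < Real.sin ((b - a) / 2) :=
    Real.sin_pos_of_pos_of_lt_pi (by linarith) (by linarith)
  unfold pdist
  rw [Real.sqrt_eq_iff_mul_self_eq_of_pos (by positivity)]
  unfold sqDist
  obtain ⟨u, rfl⟩ : ∃ u, b = a + 2 * u := ⟨(b - a) / 2, by ring⟩
  have e : (a + 2 * u - a) / 2 = u := by ring
  simp only [e, Real.cos_add, Real.sin_add, Real.cos_two_mul, Real.sin_two_mul]
  have h1 := Real.sin_sq_add_cos_sq a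
  have h2 : Real.cos u ^ 2 = 1 - Real.sin u ^ 2 := by linarith [Real.sin_sq_add_cos_sq u]
  have h3 : Real.sin a ^ 2 = 1 - Real.cos a ^ 2 := by linarith
  rw [h2]
  ring_nf
  simp only [h2, h3]
  ring

theorem aux_S4 (O : ℝ × ℝ) (R a b c : ℝ) :
    S4 (O.1 + R * Real.cos a, O.2 + R * Real.sin a)
      (O.1 + R * Real.cos b, O.2 + R * Real.sin b)
      (O.1 + R * Real.cos c, O.2 + R * Real.sin c) =
    8 * R ^ 2 * Real.sin ((b - a) / 2) * Real.sin ((c - a) / 2) * Real.sin ((c - b) / 2) := by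
  have e1 : S4 (O.1 + R * Real.cos a, O.2 + R * Real.sin a)
      (O.1 + R * Real.cos b, O.2 + R * Real.sin b)
      (O.1 + R * Real.cos c, O.2 + R * Real.sin c) =
      2 * R ^ 2 * (Real.sin (b - a) + Real.sin (c - b) - Real.sin (c - a)) := by
    unfold S4
    simp only [Real.sin_sub]
    ring
  rw [e1]
  obtain ⟨u, rfl⟩ : ∃ u, b = a + 2 * u := ⟨(b - a) / 2, by ring⟩
  obtain ⟨v, rfl⟩ : ∃ v, c = a + 2 * u + 2 * v := ⟨(c - (a + 2 * u)) / 2, by ring⟩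
  have e1 : a + 2 * u - a = 2 * u := by ring
  have e2 : a + 2 * u + 2 * v - (a + 2 * u) = 2 * v := by ring
  have e3 : a + 2 * u + 2 * v - a = 2 * (u + v) := by ring
  have e4 (x : ℝ) : 2 * x / 2 = x := by ring
  simp only [e1, e2, e3, e4, Real.sin_two_mul, Real.sin_add, Real.cos_add]
  have h2 : Real.cos u ^ 2 = 1 - Real.sin u ^ 2 := by linarith [Real.sin_sq_add_cos_sq u]
  have h3 : Real.cos v ^ 2 = 1 - Real.sin v ^ 2 := by linarith [Real.sin_sq_add_cos_sq v]
  ring_nf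
  simp only [h2, h3]
  ring

theorem aux_pair (g : ℤ → ℝ) (m : ℕ) :
    ∏ j ∈ Finset.Icc (3 : ℤ) (2 * m + 2), g j =
      ∏ l ∈ (Finset.Icc (3 : ℤ) (2 * m + 1)).filter (fun l => Odd l), g l * g (l + 1) := by
  induction m with
  | zero => simp
  | succ m ih =>
    have e1 : Finset.Icc (3 : ℤ) (2 * ((m + 1 : ℕ) : ℤ) + 2) =
        insert (2 * (m : ℤ) + 3) (insert (2 * (m : ℤ) + 3 + 1) (Finset.Icc (3 : ℤ) (2 * m + 2))) := by
      ext x; simp only [Finset.mem_insert, Finset.mem_Icc]; push_cast; omega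
    have e2 : (Finset.Icc (3 : ℤ) (2 * ((m + 1 : ℕ) : ℤ) + 1)).filter (fun l => Odd l) =
        insert (2 * (m : ℤ) + 3) ((Finset.Icc (3 : ℤ) (2 * m + 1)).filter (fun l => Odd l)) := by
      ext x
      simp only [Finset.mem_insert, Finset.mem_filter, Finset.mem_Icc, Int.odd_iff]
      push_cast; omega
    rw [e1, e2, Finset.prod_insert, Finset.prod_insert, Finset.prod_insert, ih]
    · ring
    all_goals simp

theorem aux_even (c : ℝ) (a : ℕ) :
    ∏ _k ∈ (Finset.Icc (2 : ℤ) (2 * a)).filter (fun k => Even k), c = c ^ a := by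
  induction a with
  | zero => simp
  | succ m ih =>
    have e2 : (Finset.Icc (2 : ℤ) (2 * ((m + 1 : ℕ) : ℤ))).filter (fun l => Even l) =
        insert (2 * (m : ℤ) + 2) ((Finset.Icc (2 : ℤ) (2 * m)).filter (fun l => Even l)) := by
      ext x
      simp only [Finset.mem_insert, Finset.mem_filter, Finset.mem_Icc, Int.even_iff]
      push_cast; omega
    rw [e2, Finset.prod_insert, ih]
    · ring
    · simp

theorem stmt13 (n : ℤ) (hn : 4 < n) (hne : Even n) (A : ℤ → ℝ × ℝ)
    (O : ℝ × ℝ) (R : ℝ) (θ : ℤ → ℝ) (hR : 0 < R)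
    (hmono : ∀ i, 1 ≤ i → i < n → θ i < θ (i + 1))
    (hwrap : θ n < θ 1 + 2 * Real.pi)
    (hA : ∀ i, 1 ≤ i → i ≤ n → A i = (O.1 + R * Real.cos (θ i), O.2 + R * Real.sin (θ i))) :
    deltaProd A n 1 =
      (∏ k ∈ Finset.Icc 1 (n-3),
        ∏ l ∈ (Finset.Icc (k+2) (n-1)).filter (fun l => Odd l),
          (S4 (A (k+1)) (A l) (A (l+1)) * R)) *
      (∏ k ∈ (Finset.Icc 2 (n-3)).filter (fun k => Even k),
        ∏ l ∈ (Finset.Icc (k+2) (n-1)).filter (fun l => Odd l),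
          (1 / sqDist (A l) (A (l+1)))) := by
  have hlt := aux_theta_lt n θ hmono
  have hw : ∀ i j, 1 ≤ i → i < j → j ≤ n → θ j < θ i + 2 * Real.pi := by
    intro i j hi hij hj
    have h1 : θ 1 ≤ θ i := by
      rcases eq_or_lt_of_le hi with h | h
      · rw [h]
      · exact (hlt 1 i le_rfl h (by omega)).le
    have h2 : θ j ≤ θ n := by
      rcases eq_or_lt_of_le hj with h | h
      · rw [h]
      · exact (hlt j n (by omega) h le_rfl).le
    linarith
  have hd : ∀ i j, 1 ≤ i → i < j → j ≤ n →
      pdist (A i) (A j) = 2 * R * Real.sin ((θ j - θ i) / 2) := by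
    intro i j hi hij hj
    rw [hA i hi (by omega), hA j (by omega) hj]
    exact aux_pdist O R _ _ hR (hlt i j hi hij hj) (hw i j hi hij hj)
  have hpos : ∀ i j, 1 ≤ i → i < j → j ≤ n → 0 < pdist (A i) (A j) := by
    intro i j hi hij hj
    rw [hd i j hi hij hj]
    have := Real.sin_pos_of_pos_of_lt_pi (x := (θ j - θ i) / 2)
      (by linarith [hlt i j hi hij hj]) (by linarith [hw i j hi hij hj])
    positivity
  have hS : ∀ i l, 1 ≤ i → i < l → l + 1 ≤ n → S4 (A i) (A l) (A (l + 1)) * R =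
      pdist (A i) (A l) * pdist (A i) (A (l + 1)) * pdist (A l) (A (l + 1)) := by
    intro i l hi hil hl
    rw [hd i l hi hil (by omega), hd i (l + 1) hi (by omega) hl,
      hd l (l + 1) (by omega) (by omega) hl, hA i hi (by omega),
      hA l (by omega) (by omega), hA (l + 1) (by omega) hl, aux_S4]
    ring
  have hsq : ∀ P Q, sqDist P Q = pdist P Q ^ 2 := by
    intro P Q
    unfold pdist
    rw [Real.sq_sqrt]
    unfold sqDist; positivity
  obtain ⟨m, rfl⟩ : ∃ m : ℕ, n = 2 * m + 2 := by
    obtain ⟨k, hk⟩ := hne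
    exact ⟨(k - 1).toNat, by omega⟩
  have hL : deltaProd A (2 * m + 2) 1 = ∏ j ∈ Finset.Icc (3 : ℤ) (2 * m + 2),
      ∏ i ∈ Finset.Icc 2 (j - 1), pdist (A i) (A j) := by
    unfold deltaProd
    apply Finset.prod_comm'
    intro x y
    simp only [Finset.mem_filter, Finset.mem_Icc]
    omega
  rw [hL, aux_pair]
  have hR1 : (∏ k ∈ Finset.Icc (1 : ℤ) (2 * m + 2 - 3),
        ∏ l ∈ (Finset.Icc (k+2) (2 * m + 2 - 1)).filter (fun l => Odd l),
          (S4 (A (k+1)) (A l) (A (l+1)) * R)) =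
      ∏ l ∈ (Finset.Icc (3 : ℤ) (2 * m + 1)).filter (fun l => Odd l),
        ∏ k ∈ Finset.Icc 1 (l - 2), (S4 (A (k+1)) (A l) (A (l+1)) * R) := by
    apply Finset.prod_comm'
    intro x y
    simp only [Finset.mem_filter, Finset.mem_Icc, Int.odd_iff]
    omega
  have hR2 : (∏ k ∈ (Finset.Icc (2 : ℤ) (2 * m + 2 - 3)).filter (fun k => Even k),
        ∏ l ∈ (Finset.Icc (k+2) (2 * m + 2 - 1)).filter (fun l => Odd l),
          (1 / sqDist (A l) (A (l+1)))) =
      ∏ l ∈ (Finset.Icc (3 : ℤ) (2 * m + 1)).filter (fun l => Odd l),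
        ∏ k ∈ (Finset.Icc 2 (l - 3)).filter (fun k => Even k),
          (1 / sqDist (A l) (A (l+1))) := by
    apply Finset.prod_comm'
    intro x y
    simp only [Finset.mem_filter, Finset.mem_Icc, Int.odd_iff, Int.even_iff]
    omega
  rw [hR1, hR2, ← Finset.prod_mul_distrib]
  apply Finset.prod_congr rfl
  intro l hl
  simp only [Finset.mem_filter, Finset.mem_Icc, Int.odd_iff] at hl
  obtain ⟨a, rfl⟩ : ∃ a : ℕ, l = 2 * a + 3 := ⟨((l - 3) / 2).toNat, by omega⟩
  set l : ℤ := 2 * a + 3 with hldef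
  have hp := hpos l (l + 1) (by omega) (by omega) (by omega)
  have e1 : l - 3 = 2 * (a : ℤ) := by omega
  rw [e1, aux_even, hsq]
  have e2 : ∏ k ∈ Finset.Icc 1 (l - 2), (S4 (A (k+1)) (A l) (A (l+1)) * R) =
      ∏ i ∈ Finset.Icc 2 (l - 1), (pdist (A i) (A l) * pdist (A i) (A (l + 1)) *
        pdist (A l) (A (l + 1))) := by
    apply Finset.prod_bij (fun k _ => k + 1)
    · intro k hk; simp only [Finset.mem_Icc] at hk ⊢; omega
    · intro x _ y _ h; omega
    · intro b hb; simp only [Finset.mem_Icc] at hb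
      exact ⟨b - 1, by simp only [Finset.mem_Icc]; omega, by ring⟩
    · intro k hk; simp only [Finset.mem_Icc] at hk
      exact hS (k + 1) l (by omega) (by omega) (by omega)
  have e3 : Finset.Icc 2 (l + 1 - 1) = insert l (Finset.Icc 2 (l - 1)) := by
    ext x; simp only [Finset.mem_insert, Finset.mem_Icc]; omega
  have hc : (Finset.Icc 2 (l - 1)).card = 2 * a + 1 := by
    rw [Int.card_Icc]; omega
  rw [e2, e3, Finset.prod_insert (by simp), Finset.prod_mul_distrib, Finset.prod_mul_distrib,
    Finset.prod_const, hc]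
  have hne0 := hp.ne'
  generalize pdist (A l) (A (l + 1)) = d at *
  have : d ^ (2 * a + 1) * (1 / d ^ 2) ^ a = d := by
    rw [one_div, inv_pow, ← pow_mul, pow_succ]
    field_simp
  rw [mul_assoc _ (d ^ (2 * a + 1)), this]
  ring
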